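/- Let 𝒢 be a finite simple graph of order n whose maximal vertex degree is d ≥ 3, and suppose 𝒢 is K_{d+1}-free. Then n ≤ α(𝒢)·d, where α(𝒢) is the independence number of 𝒢. -/

import Mathlib

open Finset in
/-- If the independent set `I` is maximum in `G[S]` and `#I * d < #S`, where `G[S]` has maximum
degree at most `d`, then `G[S]` contains a clique with at least `d` vertices: some vertex of `I`
together with its private neighbours. -/
theorem SimpleGraph.exists_isClique_of_card_indepSet_mul_lt {V : Type*} [DecidableEq V]
    (G : SimpleGraph V) [DecidableRel G.Adj] {d : ℕ} (hd : 2 ≤ d) {S I : Finset V} (hIS : I ⊆ S)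
    (hdeg : ∀ v ∈ S, #{u ∈ S | G.Adj v u} ≤ d)
    (hI : ∀ u ∈ I, ∀ w ∈ I, ¬ G.Adj u w)
    (hmax : ∀ J ⊆ S, (∀ u ∈ J, ∀ w ∈ J, ¬ G.Adj u w) → #J ≤ #I)
    (hlt : #I * d < #S) :
    ∃ K ⊆ S, G.IsClique (K : Set V) ∧ d ≤ #K := by
  set P : V → Finset V := fun v ↦ {u ∈ S \ I | ∀ w ∈ I, G.Adj w u ↔ w = v} with hP
  have hclique : ∀ v ∈ I, G.IsClique (P v : Set V) := by
    intro v hv x hx y hy hxy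
    by_contra hadj
    simp only [hP, coe_filter, mem_sdiff, Set.mem_ofPred_eq] at hx hy
    have hxI : x ∉ insert y (I.erase v) := by simp [hxy, hx.1.2]
    have hyI : y ∉ I.erase v := by simp [hy.1.2]
    have hle := hmax (insert x (insert y (I.erase v))) (by
      intro u hu
      simp only [mem_insert, mem_erase] at hu
      rcases hu with rfl | rfl | hu
      exacts [hx.1.1, hy.1.1, hIS hu.2]) (by
      intro u hu w hw huw
      simp only [mem_insert, mem_erase] at hu hw
      rcases hu with rfl | rfl | hu <;> rcases hw with rfl | rfl | hw
      · exact G.loopless.irrefl _ huw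
      · exact hadj huw
      · exact hw.1 ((hx.2 w hw.2).1 huw.symm)
      · exact hadj huw.symm
      · exact G.loopless.irrefl _ huw
      · exact hw.1 ((hy.2 w hw.2).1 huw.symm)
      · exact hu.1 ((hx.2 u hu.2).1 huw)
      · exact hu.1 ((hy.2 u hu.2).1 huw)
      · exact hI u hu.2 w hw.2 huw)
    rw [card_insert_of_notMem hxI, card_insert_of_notMem hyI, card_erase_of_mem hv] at hle
    have := card_pos.2 ⟨v, hv⟩
    omega
  obtain ⟨v, hv, hPv⟩ : ∃ v ∈ I, d - 1 ≤ #(P v) := by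
    by_contra! hsmall
    have hlower : ∀ u ∈ S \ I,
        2 ≤ ∑ v ∈ I, ((if G.Adj v u then 1 else 0) + (if u ∈ P v then 1 else 0)) := by
      intro u hu
      have hu' := mem_sdiff.1 hu
      obtain ⟨v, hv, hvu⟩ : ∃ v ∈ I, G.Adj v u := by
        by_contra! hnone
        have hle := hmax (insert u I) (insert_subset hu'.1 hIS) (by
          intro a ha b hb hab
          rcases mem_insert.1 ha with hau | haI <;> rcases mem_insert.1 hb with hbu | hbI
          · exact hab.ne (hau.trans hbu.symm)
          · exact hnone b hbI (hau ▸ hab.symm)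
          · exact hnone a haI (hbu ▸ hab)
          · exact hI a haI b hbI hab)
        rw [card_insert_of_notMem hu'.2] at hle
        omega
      by_cases huP : u ∈ P v
      · refine le_trans ?_ (single_le_sum (fun _ _ ↦ Nat.zero_le _) hv)
        simp [hvu, huP]
      · obtain ⟨w, hw, hwu, hwv⟩ : ∃ w ∈ I, G.Adj w u ∧ w ≠ v := by
          by_contra! hnone
          refine huP (mem_filter.2 ⟨hu, fun w hw ↦ ⟨hnone w hw, ?_⟩⟩)
          rintro rfl
          exact hvu
        refine le_trans ?_ (sum_le_sum_of_subset (s := {v, w}) (by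
          simp [insert_subset_iff, hv, hw]))
        rw [sum_pair hwv.symm]
        simp only [hvu, hwu, if_true]
        omega
    have hupper : ∀ v ∈ I,
        ∑ u ∈ S \ I, ((if G.Adj v u then 1 else 0) + (if u ∈ P v then 1 else 0)) ≤ 2 * d - 2 := by
      intro v hv
      rw [sum_add_distrib, ← card_filter, ← card_filter]
      have h₁ : #{u ∈ S \ I | G.Adj v u} ≤ d :=
        (card_le_card (filter_subset_filter _ sdiff_subset)).trans (hdeg v (hIS hv))
      have h₂ : #{u ∈ S \ I | u ∈ P v} ≤ #(P v) :=
        card_le_card fun u hu ↦ (mem_filter.1 hu).2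
      have := hsmall v hv
      omega
    have hcount := (card_nsmul_le_sum _ _ _ hlower).trans
      (sum_comm.trans_le (sum_le_card_nsmul _ _ _ hupper))
    rw [card_sdiff_of_subset hIS, smul_eq_mul, smul_eq_mul] at hcount
    obtain ⟨e, rfl⟩ := Nat.exists_eq_add_of_le' hd
    have : 2 * (e + 2) - 2 = 2 * (e + 1) := by omega
    rw [this] at hcount
    have := card_le_card hIS
    zify [this] at hcount hlt
    nlinarith
  refine ⟨insert v (P v), insert_subset (hIS hv) fun u hu ↦ ?_, ?_, ?_⟩
  · exact (mem_sdiff.1 (mem_filter.1 hu).1).1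
  · rw [coe_insert, SimpleGraph.isClique_insert]
    exact ⟨hclique v hv, fun u hu _ ↦ ((mem_filter.1 hu).2 v hv).2 rfl⟩
  · have hvP : v ∉ P v := fun h ↦ (mem_sdiff.1 (mem_filter.1 h).1).2 hv
    have := card_insert_of_notMem hvP
    omega

open Finset in
/-- If `G[S]` has maximum degree at most `d`, with `3 ≤ d`, and has no clique with more than `d`
vertices, then it contains an independent set with at least `#S / d` vertices. -/
theorem SimpleGraph.exists_indepSet_card_le_mul {V : Type*} [DecidableEq V] {d : ℕ} (hd : 3 ≤ d)
    (G : SimpleGraph V) [DecidableRel G.Adj] (S : Finset V)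
    (hdeg : ∀ v ∈ S, #{u ∈ S | G.Adj v u} ≤ d)
    (hfree : ∀ T ⊆ S, G.IsClique (T : Set V) → #T ≤ d) :
    ∃ I ⊆ S, (∀ u ∈ I, ∀ w ∈ I, ¬ G.Adj u w) ∧ #S ≤ #I * d := by
  classical
  induction hn : #S using Nat.strong_induction_on generalizing G S with
  | _ n ih =>
  subst hn
  -- the induction hypothesis for induced subgraphs of `G`
  have ihG : ∀ T ⊂ S, ∃ I ⊆ T, (∀ u ∈ I, ∀ w ∈ I, ¬ G.Adj u w) ∧ #T ≤ #I * d := fun T hT ↦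
    ih #T (card_lt_card hT) G T
      (fun v hv ↦ (card_le_card (filter_subset_filter _ hT.1)).trans (hdeg v (hT.1 hv)))
      (fun U hU ↦ hfree U (hU.trans hT.1)) rfl
  by_contra! hcon
  -- no large independent `J ⊆ A` is compatible with a large independent set of `G[S \ A]`
  have hextend : ∀ A J I : Finset V, A ⊆ S → J ⊆ A → #A ≤ #J * d → I ⊆ S \ A →
      #(S \ A) ≤ #I * d → (∀ u ∈ I, ∀ w ∈ I, ¬ G.Adj u w) → (∀ u ∈ J, ∀ w ∈ J, ¬ G.Adj u w) →
      (∀ u ∈ J, ∀ w ∈ I, ¬ G.Adj u w) → False := by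
    intro A J I hA hJA hAJ hIA hcard hI hJ hJI
    have hdisj : Disjoint J I :=
      (disjoint_sdiff (s := A) (t := S)).mono hJA hIA
    have hlt := hcon (J ∪ I) (union_subset (hJA.trans hA) (hIA.trans sdiff_subset)) (by
      intro u hu w hw huw
      rcases mem_union.1 hu with hu | hu <;> rcases mem_union.1 hw with hw | hw
      · exact hJ u hu w hw huw
      · exact hJI u hu w hw huw
      · exact hJI w hw u hu huw.symm
      · exact hI u hu w hw huw)
    rw [card_union_of_disjoint hdisj, add_mul] at hlt
    have := card_sdiff_add_card_eq_card hA
    omega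
  obtain ⟨K, hKS, hK, hKd⟩ : ∃ K ⊆ S, G.IsClique (K : Set V) ∧ d ≤ #K := by
    obtain ⟨I, hI, hmax⟩ := exists_max_image
      {I ∈ S.powerset | ∀ u ∈ I, ∀ w ∈ I, ¬ G.Adj u w} card ⟨∅, by simp⟩
    simp only [mem_filter, mem_powerset] at hI hmax
    exact G.exists_isClique_of_card_indepSet_mul_lt (by omega) hI.1 hdeg hI.2
      (fun J hJ hJ' ↦ hmax J ⟨hJ, hJ'⟩) (hcon I hI.1 hI.2)
  replace hKd : #K = d := le_antisymm (hfree K hKS hK) hKd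
  have hKne : K.Nonempty := card_pos.1 (by omega)
  have hss : S \ K ⊂ S := sdiff_ssubset hKS hKne
  have hout : ∀ p ∈ K, ∃ p' ∈ S \ K, G.Adj p p' := by
    intro p hp
    by_contra! hnone
    obtain ⟨I, hIK, hI, hcard⟩ := ihG _ hss
    exact hextend K {p} I hKS (by simpa using hp) (by simp [hKd]) hIK hcard hI (by simp)
      (by simpa using fun w hw ↦ hnone w (hIK hw))
  have hnbr : ∀ p ∈ K, ∀ x ∈ S \ K, G.Adj p x → {u ∈ S | G.Adj p u} = insert x (K.erase p) := by
    intro p hp x hx hpx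
    symm
    apply eq_of_subset_of_card_le
    · intro u hu
      rcases mem_insert.1 hu with rfl | hu
      · exact mem_filter.2 ⟨(mem_sdiff.1 hx).1, hpx⟩
      · have hu := mem_erase.1 hu
        exact mem_filter.2 ⟨hKS hu.2, hK hp hu.2 hu.1.symm⟩
    · rw [card_insert_of_notMem (by simp [(mem_sdiff.1 hx).2]), card_erase_of_mem hp, hKd]
      have := hdeg p (hKS hp)
      omega
  have huniq : ∀ p ∈ K, ∀ x ∈ S \ K, G.Adj p x → ∀ y ∈ S \ K, G.Adj p y → y = x := by
    intro p hp x hx hpx y hy hpy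
    have hmem : y ∈ insert x (K.erase p) := by
      rw [← hnbr p hp x hx hpx]
      exact mem_filter.2 ⟨(mem_sdiff.1 hy).1, hpy⟩
    rcases mem_insert.1 hmem with h | h
    · exact h
    · exact absurd (mem_erase.1 h).2 (mem_sdiff.1 hy).2
  obtain ⟨p, hp⟩ := hKne
  obtain ⟨x, hx, hpx⟩ := hout p hp
  obtain ⟨q, hq, hqx⟩ : ∃ q ∈ K, ¬ G.Adj q x := by
    by_contra! hall
    have hle := hfree (insert x K) (insert_subset (mem_sdiff.1 hx).1 hKS) (by
      rw [coe_insert, SimpleGraph.isClique_insert]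
      exact ⟨hK, fun u hu _ ↦ (hall u hu).symm⟩)
    rw [card_insert_of_notMem (mem_sdiff.1 hx).2] at hle
    omega
  obtain ⟨y, hy, hqy⟩ := hout q hq
  have hxy : x ≠ y := by
    rintro rfl
    exact hqx hqy
  have hpq : p ≠ q := by
    rintro rfl
    exact hqx hpx
  -- an independent set of the right size in `G[S \ K]` must contain both `x` and `y`
  have hmust : ∀ r ∈ K, ∀ z ∈ S \ K, G.Adj r z → ∀ I ⊆ S \ K, (∀ u ∈ I, ∀ w ∈ I, ¬ G.Adj u w) →
      #(S \ K) ≤ #I * d → z ∈ I := by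
    intro r hr z hz hrz I hIK hI hcard
    by_contra hzI
    refine hextend K {r} I hKS (by simpa using hr) (by simp [hKd]) hIK hcard hI (by simp) ?_
    simp only [mem_singleton, forall_eq]
    intro w hw hrw
    exact hzI (huniq r hr z hz hrz w (hIK hw) hrw ▸ hw)
  have hnadj : ¬ G.Adj x y := by
    obtain ⟨I, hIK, hI, hcard⟩ := ihG _ hss
    exact hI x (hmust p hp x hx hpx I hIK hI hcard) y (hmust q hq y hy hqy I hIK hI hcard)
  set H := G ⊔ SimpleGraph.edge x y with hH
  have hHadj : ∀ u w, H.Adj u w ↔ G.Adj u w ∨ (u = x ∧ w = y ∨ u = y ∧ w = x) := by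
    intro u w
    rw [hH, SimpleGraph.sup_adj, SimpleGraph.edge_adj]
    constructor
    · tauto
    · rintro (h | ⟨rfl, rfl⟩ | ⟨rfl, rfl⟩)
      · exact Or.inl h
      · simp [hxy]
      · simp [hxy.symm]
  have hHdeg : ∀ v ∈ S \ K, #{u ∈ S \ K | H.Adj v u} ≤ d := by
    -- the new edge replaces the edge from `z` to `r`
    have hend : ∀ r ∈ K, ∀ z ∈ S \ K, G.Adj r z → ∀ t, (∀ u, H.Adj z u → G.Adj z u ∨ u = t) →
        #{u ∈ S \ K | H.Adj z u} ≤ d := by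
      intro r hr z hz hrz t ht
      have hsub : {u ∈ S \ K | H.Adj z u} ⊆ insert t ({u ∈ S | G.Adj z u}.erase r) := by
        intro u hu
        obtain ⟨huK, hzu⟩ := mem_filter.1 hu
        rcases ht u hzu with h | rfl
        · refine mem_insert_of_mem (mem_erase.2 ⟨?_, mem_filter.2 ⟨(mem_sdiff.1 huK).1, h⟩⟩)
          rintro rfl
          exact (mem_sdiff.1 huK).2 hr
        · exact mem_insert_self _ _
      have hrmem : r ∈ {u ∈ S | G.Adj z u} := mem_filter.2 ⟨hKS hr, hrz.symm⟩
      have h₁ := card_le_card hsub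
      have h₂ := card_insert_le t ({u ∈ S | G.Adj z u}.erase r)
      have h₃ := card_erase_add_one hrmem
      have h₄ := hdeg z (mem_sdiff.1 hz).1
      omega
    intro v hv
    by_cases hvx : v = x
    · subst hvx
      exact hend p hp v hv hpx y fun u hu ↦ by grind
    by_cases hvy : v = y
    · subst hvy
      exact hend q hq v hv hqy x fun u hu ↦ by grind
    refine (card_le_card fun u hu ↦ ?_).trans (hdeg v (mem_sdiff.1 hv).1)
    obtain ⟨huK, hvu⟩ := mem_filter.1 hu
    refine mem_filter.2 ⟨(mem_sdiff.1 huK).1, ?_⟩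
    simpa [hHadj, hvx, hvy] using hvu
  by_cases hHfree : ∀ T ⊆ S \ K, H.IsClique (T : Set V) → #T ≤ d
  · obtain ⟨I, hIK, hI, hcard⟩ := ih _ (card_lt_card hss) H (S \ K) hHdeg hHfree rfl
    have hI' : ∀ u ∈ I, ∀ w ∈ I, ¬ G.Adj u w := fun u hu w hw h ↦
      hI u hu w hw ((hHadj u w).2 (Or.inl h))
    exact hI x (hmust p hp x hx hpx I hIK hI' hcard) y (hmust q hq y hy hqy I hIK hI' hcard)
      ((hHadj x y).2 (by simp))
  push Not at hHfree
  obtain ⟨T, hTK, hT, hTd⟩ := hHfree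
  obtain ⟨hxT, hyT⟩ : x ∈ T ∧ y ∈ T := by
    by_contra hnot
    refine absurd (hfree T (hTK.trans sdiff_subset) fun u hu w hw huw ↦ ?_) (by omega)
    rcases (hHadj u w).1 (hT hu hw huw) with h | ⟨rfl, rfl⟩ | ⟨rfl, rfl⟩
    exacts [h, (hnot ⟨hu, hw⟩).elim, (hnot ⟨hw, hu⟩).elim]
  have hTcard : #T = d + 1 := by
    have hsub : T.erase x ⊆ {u ∈ S \ K | H.Adj x u} := fun u hu ↦
      mem_filter.2 ⟨hTK (mem_erase.1 hu).2, hT hxT (mem_erase.1 hu).2 (mem_erase.1 hu).1.symm⟩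
    have h₁ := (card_le_card hsub).trans (hHdeg x hx)
    have h₂ := card_erase_add_one hxT
    omega
  have hTnbr : ∀ r ∈ K, ∀ z ∈ T, ∀ t ∈ T, z ≠ t → G.Adj r z →
      (∀ u ∈ T, u ≠ z → u ≠ t → G.Adj z u) → ∀ w ∈ S, G.Adj z w → w ∈ insert r T := by
    intro r hr z hz t ht hzt hrz hzT w hw hzw
    have hrT : r ∉ T := fun h ↦ (mem_sdiff.1 (hTK h)).2 hr
    have hsub : insert r ((T.erase z).erase t) ⊆ {u ∈ S | G.Adj z u} := by
      intro u hu
      simp only [mem_insert, mem_erase] at hu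
      rcases hu with rfl | ⟨hut, huz, hu⟩
      · exact mem_filter.2 ⟨hKS hr, hrz.symm⟩
      · exact mem_filter.2 ⟨(mem_sdiff.1 (hTK hu)).1, hzT u hu huz hut⟩
    have heq := eq_of_subset_of_card_le hsub (by
      rw [card_insert_of_notMem (by simp [hrT]),
        card_erase_of_mem (mem_erase.2 ⟨hzt.symm, ht⟩), card_erase_of_mem hz, hTcard]
      have := hdeg z (mem_sdiff.1 (hTK hz)).1
      omega)
    have hmem : w ∈ insert r ((T.erase z).erase t) := heq ▸ mem_filter.2 ⟨hw, hzw⟩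
    simp only [mem_insert, mem_erase] at hmem ⊢
    tauto
  have hxN := hTnbr p hp x hxT y hyT hxy hpx fun u hu hux huy ↦ by
    have := (hHadj x u).1 (hT hxT hu hux.symm)
    tauto
  have hyN := hTnbr q hq y hyT x hxT hxy.symm hqy fun u hu huy hux ↦ by
    have := (hHadj y u).1 (hT hyT hu huy.symm)
    tauto
  set A := insert p (insert q T) with hA
  have hAS : A ⊆ S :=
    insert_subset (hKS hp) (insert_subset (hKS hq) (hTK.trans sdiff_subset))
  obtain ⟨I, hIA, hI, hcard⟩ := ihG (S \ A) (sdiff_ssubset hAS ⟨p, mem_insert_self _ _⟩)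
  refine hextend A {x, y} I hAS ?_ ?_ hIA hcard hI ?_ ?_
  · simp [hA, insert_subset_iff, hxT, hyT]
  · have h₁ : #A ≤ #(insert q T) + 1 := card_insert_le p _
    have h₂ := card_insert_le q T
    rw [card_pair hxy]
    omega
  · intro u hu w hw huw
    rw [mem_insert, mem_singleton] at hu hw
    rcases hu with rfl | rfl <;> rcases hw with rfl | rfl
    exacts [G.loopless.irrefl _ huw, hnadj huw, hnadj huw.symm, G.loopless.irrefl _ huw]
  · intro u hu w hw huw
    obtain ⟨hwS, hwA⟩ := mem_sdiff.1 (hIA hw)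
    simp only [hA, mem_insert, not_or] at hwA
    rcases mem_insert.1 hu with rfl | hu
    · have := hxN w hwS huw
      simp only [mem_insert] at this
      tauto
    · rw [mem_singleton] at hu
      subst hu
      have := hyN w hwS huw
      simp only [mem_insert] at this
      tauto

/-- Lemma 2.2: if a finite simple graph of order n has maximal degree d ≥ 3 and is
K_{d+1}-free, then n ≤ a * d where a is the independence number of the graph. -/
theorem card_le_indepNum_mul_maxDegree {V : Type} [Fintype V]
    (G : SimpleGraph V) [DecidableRel G.Adj] (d a : ℕ) (hd : 3 ≤ d)
    (hmax : ∀ v, G.degree v ≤ d) (hattained : ∃ v, G.degree v = d)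
    (hfree : G.CliqueFree (d + 1))
    (ha : IsGreatest {n | ∃ s : Finset V, (∀ u ∈ s, ∀ w ∈ s, ¬ G.Adj u w) ∧ s.card = n} a) :
    Fintype.card V ≤ a * d := by
  classical
  obtain ⟨I, -, hI, hcard⟩ := G.exists_indepSet_card_le_mul hd Finset.univ
    (fun v _ ↦ by
      rw [← SimpleGraph.neighborFinset_eq_filter, SimpleGraph.card_neighborFinset_eq_degree]
      exact hmax v)
    (fun T _ hT ↦ by
      by_contra! hlt
      exact hfree.mono hlt T ⟨hT, rfl⟩)
  exact hcard.trans (Nat.mul_le_mul_right d (ha.2 ⟨I, hI, rfl⟩))
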